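/- (One-dimensional scalar version of the weighted interpolation with epsilon.) Let ζ ∈ C_c^∞(ℝ), ζ ≥ 0, |ζ'| ≤ Λ, and let k ≥ 2 and 1 ≤ i < k be integers. There exists C = C(Λ, i, k) > 0 such that for every u ∈ C^∞(ℝ) and every ε ∈ (0,1]: ∫ |u^{(i)}|² ζ^{2i} dx ≤ ε ∫ |u^{(k)}|² ζ^{2k} dx + C ε^{i/(i-k)} ∫_{[ζ>0]} |u|² dx. -/

import Mathlib

open MeasureTheory Filter
open scoped Topology

/-- A sequence satisfying one-step interpolation inequalities with arbitrarily small leading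
constant interpolates each term between its successor and its initial term. -/
lemma exists_le_mul_succ_add_of_one_step (K : ℕ → ℝ) (hK : ∀ j, 0 < K j) (j : ℕ) :
    ∀ η : ℝ, 0 < η → η ≤ 1 → ∃ C : ℝ, 0 < C ∧ ∀ b : ℕ → ℝ, (∀ n, 0 ≤ b n) →
      (∀ n, ∀ δ : ℝ, 0 < δ → δ ≤ 1 → b (n + 1) ≤ δ * b (n + 2) + K n / δ * b n) →
      b j ≤ η * b (j + 1) + C * b 0 := by
  induction j with
  | zero =>
    intro η hη _
    refine ⟨1, one_pos, fun b hb _ => ?_⟩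
    have := mul_nonneg hη.le (hb (0 + 1))
    linarith
  | succ j ih =>
    intro η hη hη1
    have hKj := hK j
    obtain ⟨C, hC, h⟩ := ih (min 1 (η / (4 * K j))) (by positivity) (min_le_left _ _)
    refine ⟨4 * K j / η * C, by positivity, fun b hb hstep => ?_⟩
    have h₁ := h b hb hstep
    have h₂ := hstep j (η / 2) (by positivity) (by linarith)
    have h₃ : min 1 (η / (4 * K j)) * b (j + 1) ≤ η / (4 * K j) * b (j + 1) :=
      mul_le_mul_of_nonneg_right (min_le_right _ _) (hb _)
    have h₄ : K j / (η / 2) * b j ≤ K j / (η / 2) * (η / (4 * K j) * b (j + 1) + C * b 0) :=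
      mul_le_mul_of_nonneg_left (by linarith) (by positivity)
    have h₅ : K j / (η / 2) * (η / (4 * K j) * b (j + 1) + C * b 0) =
        b (j + 1) / 2 + (4 * K j / η * C * b 0) / 2 := by
      field_simp
      ring
    have h₆ : η / 2 * b (j + 2) = η * b (j + 1 + 1) / 2 := by ring
    linarith

/-- A sequence satisfying one-step interpolation inequalities interpolates each term between any
later term and its initial term. -/
lemma exists_le_add_of_one_step (K : ℕ → ℝ) (hK : ∀ j, 0 < K j) {i k : ℕ} (hik : i < k) :
    ∃ C : ℝ, 0 < C ∧ ∀ b : ℕ → ℝ, (∀ n, 0 ≤ b n) →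
      (∀ n, ∀ δ : ℝ, 0 < δ → δ ≤ 1 → b (n + 1) ≤ δ * b (n + 2) + K n / δ * b n) →
      b i ≤ b k + C * b 0 := by
  induction k, hik using Nat.le_induction with
  | base =>
    obtain ⟨C, hC, h⟩ := exists_le_mul_succ_add_of_one_step K hK i 1 one_pos le_rfl
    exact ⟨C, hC, fun b hb hstep => by simpa using h b hb hstep⟩
  | succ k _ ih =>
    obtain ⟨C, hC, h⟩ := ih
    obtain ⟨C', hC', h'⟩ := exists_le_mul_succ_add_of_one_step K hK k 1 one_pos le_rfl
    refine ⟨C + C', by positivity, fun b hb hstep => ?_⟩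
    have h₁ := h b hb hstep
    have h₂ := h' b hb hstep
    linarith

/-- Scaling-invariant form of sequence interpolation, with the sharp power of `ε`. -/
lemma exists_le_mul_add_rpow_of_one_step (K : ℕ → ℝ) (hK : ∀ j, 0 < K j) {i k : ℕ}
    (hik : i < k) :
    ∃ C : ℝ, 0 < C ∧ ∀ a : ℕ → ℝ, (∀ n, 0 ≤ a n) →
      (∀ n, ∀ δ : ℝ, 0 < δ → δ ≤ 1 → a (n + 1) ≤ δ * a (n + 2) + K n / δ * a n) →
      ∀ ε : ℝ, 0 < ε → ε ≤ 1 →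
        a i ≤ ε * a k + C * ε ^ ((i : ℝ) / ((i : ℝ) - (k : ℝ))) * a 0 := by
  obtain ⟨C, hC, h⟩ := exists_le_add_of_one_step K hK hik
  refine ⟨C, hC, fun a ha hstep ε hε hε1 => ?_⟩
  have hki : (0 : ℝ) < (k : ℝ) - i := sub_pos.2 (by exact_mod_cast hik)
  set t : ℝ := ε ^ (1 / ((k : ℝ) - i)) with ht
  have ht0 : 0 < t := Real.rpow_pos_of_pos hε _
  have ht1 : t ≤ 1 := Real.rpow_le_one hε.le hε1 (by positivity)
  have htε : t ^ k = t ^ i * ε := by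
    have : t ^ (k - i) = ε := by
      rw [ht, ← Real.rpow_natCast, ← Real.rpow_mul hε.le, Nat.cast_sub hik.le,
        one_div_mul_cancel hki.ne', Real.rpow_one]
    rw [← this, ← pow_add, Nat.add_sub_cancel' hik.le]
  have hti : t ^ i * ε ^ ((i : ℝ) / ((i : ℝ) - (k : ℝ))) = 1 := by
    rw [ht, ← Real.rpow_natCast, ← Real.rpow_mul hε.le, ← Real.rpow_add hε,
      ← neg_sub (k : ℝ) i, div_neg, one_div_mul_eq_div, add_neg_cancel, Real.rpow_zero]
  have key := h (fun n => t ^ n * a n) (fun n => mul_nonneg (by positivity) (ha n)) ?_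
  · refine le_of_mul_le_mul_left ?_ (pow_pos ht0 i)
    calc t ^ i * a i ≤ t ^ k * a k + C * (t ^ 0 * a 0) := key
      _ = t ^ i * ε * a k + C * (t ^ i * ε ^ ((i : ℝ) / ((i : ℝ) - (k : ℝ)))) * a 0 := by
        rw [htε, hti]; ring
      _ = _ := by ring
  · intro n δ hδ hδ1
    have h₁ := mul_le_mul_of_nonneg_left
      (hstep n (δ * t) (by positivity) (mul_le_one₀ hδ1 ht0.le ht1)) (pow_pos ht0 (n + 1)).le
    calc t ^ (n + 1) * a (n + 1) ≤ _ := h₁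
      _ = δ * (t ^ (n + 2) * a (n + 2)) + K n / δ * (t ^ n * a n) := by
        field_simp
        ring

section WeightedIntegrals

variable {ζ u : ℝ → ℝ}

lemma integrableOn_pos_of_continuous (hζ : HasCompactSupport ζ) {f : ℝ → ℝ} (hf : Continuous f) :
    IntegrableOn f {x | 0 < ζ x} :=
  (hf.continuousOn.integrableOn_compact hζ).mono_set
    fun _ hx => subset_tsupport ζ (ne_of_gt hx)

/-- The one-step weighted interpolation estimate, obtained by integrating by parts. -/
lemma setIntegral_iteratedDeriv_sq_mul_pow_le {Λ : ℝ}
    (hζ : ContDiff ℝ (⊤ : ℕ∞) ζ) (hζc : HasCompactSupport ζ) (hζ0 : ∀ x, 0 ≤ ζ x)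
    (hζ' : ∀ x, |deriv ζ x| ≤ Λ) (hu : ContDiff ℝ (⊤ : ℕ∞) u) (n : ℕ)
    {δ : ℝ} (hδ : 0 < δ) :
    ∫ x in {x | 0 < ζ x}, iteratedDeriv (n + 1) u x ^ 2 * ζ x ^ (2 * (n + 1)) ≤
      δ * (∫ x in {x | 0 < ζ x}, iteratedDeriv (n + 2) u x ^ 2 * ζ x ^ (2 * (n + 2))) +
      (1 / δ + 4 * ((n : ℝ) + 1) ^ 2 * Λ ^ 2) *
        ∫ x in {x | 0 < ζ x}, iteratedDeriv n u x ^ 2 * ζ x ^ (2 * n) := by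
  have hcu : ∀ m, Continuous (iteratedDeriv m u) := fun m =>
    hu.continuous_iteratedDeriv m (by exact_mod_cast le_top)
  have hcζ : Continuous ζ := hζ.continuous
  have hcζ' : Continuous (deriv ζ) := hζ.continuous_deriv (by exact_mod_cast le_top)
  have hdu : ∀ m x, HasDerivAt (iteratedDeriv m u) (iteratedDeriv (m + 1) u x) x := fun m x => by
    rw [iteratedDeriv_succ]
    exact (hu.differentiable_iteratedDeriv m
      (by exact_mod_cast WithTop.coe_lt_top m) x).hasDerivAt
  have hdζ : ∀ x, HasDerivAt ζ (deriv ζ x) x := fun x =>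
    (hζ.differentiable (by simp) x).hasDerivAt
  set F : ℝ → ℝ := fun x => iteratedDeriv n u x * iteratedDeriv (n + 1) u x *
    ζ x ^ (2 * n + 2) with hF
  set F' : ℝ → ℝ := fun x =>
    (iteratedDeriv (n + 1) u x ^ 2 * ζ x ^ (2 * n + 1) +
      iteratedDeriv n u x * iteratedDeriv (n + 2) u x * ζ x ^ (2 * n + 1) +
      (2 * n + 2) * (iteratedDeriv n u x * iteratedDeriv (n + 1) u x) *
        ζ x ^ (2 * n) * deriv ζ x) * ζ x with hF'
  have hFF' : ∀ x, HasDerivAt F (F' x) x := fun x => by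
    refine (((hdu n x).mul (hdu (n + 1) x)).mul ((hdζ x).pow (2 * n + 2))).congr_deriv ?_
    simp only [hF', Pi.mul_apply, Pi.pow_apply, show 2 * n + 2 - 1 = 2 * n + 1 from rfl]
    push_cast
    ring
  have hcF : Continuous F := by fun_prop
  have hcF' : Continuous F' := by fun_prop
  have hsF : HasCompactSupport F := hζc.mono' fun x hx => subset_tsupport ζ fun h => hx (by
    simp [hF, h])
  have hsF' : HasCompactSupport F' := HasCompactSupport.mul_left hζc
  have hintF' : ∫ x, F' x = 0 := integral_eq_zero_of_hasDerivAt_of_integrable hFF'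
    (hcF'.integrable_of_hasCompactSupport hsF') (hcF.integrable_of_hasCompactSupport hsF)
  have hsetF' : ∫ x in {x | 0 < ζ x}, F' x = 0 := by
    rw [setIntegral_eq_integral_of_forall_compl_eq_zero, hintF']
    intro x hx
    have : ζ x = 0 := le_antisymm (not_lt.1 hx) (hζ0 x)
    simp [hF', this]
  have hint : ∀ m, IntegrableOn (fun x => iteratedDeriv m u x ^ 2 * ζ x ^ (2 * m))
      {x | 0 < ζ x} := fun m =>
    integrableOn_pos_of_continuous hζc (((hcu m).pow 2).mul (hcζ.pow _))
  have hpt : ∀ x, iteratedDeriv (n + 1) u x ^ 2 * ζ x ^ (2 * (n + 1)) ≤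
      2 * F' x + (δ * (iteratedDeriv (n + 2) u x ^ 2 * ζ x ^ (2 * (n + 2))) +
      (1 / δ + 4 * ((n : ℝ) + 1) ^ 2 * Λ ^ 2) * (iteratedDeriv n u x ^ 2 * ζ x ^ (2 * n))) := by
    intro x
    set X := iteratedDeriv n u x * ζ x ^ n
    set Y := iteratedDeriv (n + 1) u x * ζ x ^ (n + 1)
    set Z := iteratedDeriv (n + 2) u x * ζ x ^ (n + 2)
    have hX : iteratedDeriv n u x ^ 2 * ζ x ^ (2 * n) = X ^ 2 := by ring
    have hY : iteratedDeriv (n + 1) u x ^ 2 * ζ x ^ (2 * (n + 1)) = Y ^ 2 := by ring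
    have hZ : iteratedDeriv (n + 2) u x ^ 2 * ζ x ^ (2 * (n + 2)) = Z ^ 2 := by ring
    have hFx : F' x = Y ^ 2 + X * Z + 2 * (n + 1) * X * Y * deriv ζ x := by
      simp only [hF', X, Y, Z]
      ring
    rw [hX, hY, hZ, hFx]
    have h₁ : 0 ≤ (Y + 2 * (n + 1) * X * deriv ζ x) ^ 2 := sq_nonneg _
    have h₂ : 0 ≤ δ * Z ^ 2 + 2 * X * Z + 1 / δ * X ^ 2 := by
      have : δ * Z ^ 2 + 2 * X * Z + 1 / δ * X ^ 2 = (δ * Z + X) ^ 2 / δ := by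
        field_simp
        ring
      rw [this]
      positivity
    have h₃ : 4 * ((n : ℝ) + 1) ^ 2 * X ^ 2 * deriv ζ x ^ 2 ≤
        4 * ((n : ℝ) + 1) ^ 2 * X ^ 2 * Λ ^ 2 :=
      mul_le_mul_of_nonneg_left (sq_le_sq' (abs_le.1 (hζ' x)).1 (abs_le.1 (hζ' x)).2)
        (by positivity)
    linarith
  have hiF' : IntegrableOn (fun x => 2 * F' x) {x | 0 < ζ x} :=
    (integrableOn_pos_of_continuous hζc hcF').const_mul 2
  have hi₂ := (hint (n + 2)).const_mul δ
  have hi₀ := (hint n).const_mul (1 / δ + 4 * ((n : ℝ) + 1) ^ 2 * Λ ^ 2)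
  refine (integral_mono (hint (n + 1)) (hiF'.add (hi₂.add hi₀)) hpt).trans_eq ?_
  rw [integral_add' hiF' (hi₂.add hi₀), integral_add' hi₂ hi₀, integral_const_mul,
    integral_const_mul, integral_const_mul, hsetF', mul_zero, zero_add]

end WeightedIntegrals

/-- One-dimensional scalar weighted interpolation with epsilon: for a smooth
nonnegative compactly supported weight `ζ` with `|ζ'| ≤ Λ` and integers
`k ≥ 2`, `1 ≤ i < k`, there is `C = C(Λ, i, k) > 0` such that for every smooth
`u` and `ε ∈ (0,1]`,
`∫ |u^{(i)}|² ζ^{2i} ≤ ε ∫ |u^{(k)}|² ζ^{2k} + C ε^{i/(i-k)} ∫_{[ζ>0]} |u|²`. -/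
theorem weighted_interpolation_eps (Λ : ℝ) (hΛ : 0 ≤ Λ) (i k : ℕ)
    (hk : 2 ≤ k) (hi : 1 ≤ i) (hik : i < k) :
    ∃ C > (0:ℝ), ∀ ζ u : ℝ → ℝ,
      ContDiff ℝ (⊤ : ℕ∞) ζ → HasCompactSupport ζ → (∀ x, 0 ≤ ζ x) →
      (∀ x, |deriv ζ x| ≤ Λ) → ContDiff ℝ (⊤ : ℕ∞) u →
      ∀ ε : ℝ, 0 < ε → ε ≤ 1 →
      (∫ x : ℝ, iteratedDeriv i u x ^ 2 * ζ x ^ (2 * i)) ≤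
        ε * (∫ x : ℝ, iteratedDeriv k u x ^ 2 * ζ x ^ (2 * k)) +
        C * ε ^ ((i : ℝ) / ((i : ℝ) - (k : ℝ))) *
          ∫ x in {x : ℝ | 0 < ζ x}, u x ^ 2 := by
  obtain ⟨C, hC, h⟩ := exists_le_mul_add_rpow_of_one_step
    (fun n => 1 + 4 * ((n : ℝ) + 1) ^ 2 * Λ ^ 2) (fun n => by positivity) hik
  refine ⟨C, hC, fun ζ u hζ hζc hζ0 hζ' hu ε hε hε1 => ?_⟩
  have key := h
    (fun n => ∫ x in {x | 0 < ζ x}, iteratedDeriv n u x ^ 2 * ζ x ^ (2 * n))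
    (fun n => integral_nonneg fun x => mul_nonneg (sq_nonneg _) (pow_nonneg (hζ0 x) _)) ?_ ε hε hε1
  · have hset : ∀ m, m ≠ 0 →
        ∫ x in {x | 0 < ζ x}, iteratedDeriv m u x ^ 2 * ζ x ^ (2 * m) =
        ∫ x, iteratedDeriv m u x ^ 2 * ζ x ^ (2 * m) := fun m hm => by
      refine setIntegral_eq_integral_of_forall_compl_eq_zero fun x hx => ?_
      have : ζ x = 0 := le_antisymm (not_lt.1 hx) (hζ0 x)
      simp [this, hm]
    simpa [hset i (by omega), hset k (by omega)] using key
  · intro n δ hδ hδ1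
    refine (setIntegral_iteratedDeriv_sq_mul_pow_le hζ hζc hζ0 hζ' hu n hδ).trans ?_
    gcongr
    · exact integral_nonneg fun x => mul_nonneg (sq_nonneg _) (pow_nonneg (hζ0 x) _)
    · rw [add_div]
      gcongr
      exact le_div_self (by positivity) hδ hδ1
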